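/- For every n ≥ 1, L_n^E(x) = Σ_{k=1}^{⌊n/2⌋} L_{n,2k}·x^k·(1+x)^{n−2k} and L_n^O(x) = Σ_{k=0}^{⌊(n−1)/2⌋} L_{n,2k+1}·x^k·(1+x)^{n−1−2k}; in particular both L_n^E(x) and L_n^O(x) are γ-positive (hence symmetric and unimodal). -/

import Mathlib

open Polynomial Finset

/-- A candidate Stirling permutation of order `n`: a word of length `2n` with
letters in `[n]` (encoded as `Fin n`). -/
abbrev StWord (n : ℕ) := Fin (2 * n) → Fin n

/-- The letter of a word at position `i ∈ [2n]` (1-indexed, values in `[n]`),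
with the convention that the value is `0` outside `[1, 2n]` (so `σ_0 = 0`). -/
def qval (n : ℕ) (σ : StWord n) (i : ℕ) : ℕ :=
  if h : 1 ≤ i ∧ i ≤ 2 * n then (σ ⟨i - 1, by omega⟩ : Fin n).val + 1 else 0

/-- `σ` is a Stirling permutation: each letter of `[n]` occurs exactly twice,
and all entries between the two occurrences of any letter are larger than it. -/
def IsStirling (n : ℕ) (σ : StWord n) : Prop :=
  (∀ k : Fin n, (Finset.univ.filter (fun i => σ i = k)).card = 2) ∧
  (∀ a b c : Fin (2 * n), a < b → b < c → σ a = σ c → σ a < σ b)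

instance (n : ℕ) : DecidablePred (IsStirling n) := fun σ => by
  unfold IsStirling; infer_instance

/-- The ascent-plateau number `ap(σ) = #{i ∈ [2, 2n-1] : σ_{i-1} < σ_i = σ_{i+1}}`. -/
def ap (n : ℕ) (σ : StWord n) : ℕ :=
  ((Finset.Icc 2 (2 * n - 1)).filter
    (fun i => qval n σ (i - 1) < qval n σ i ∧ qval n σ i = qval n σ (i + 1))).card

/-- The left ascent-plateau number
`lap(σ) = #{i ∈ [2n-1] : σ_{i-1} < σ_i = σ_{i+1}}` with `σ_0 = 0`. -/
def lap (n : ℕ) (σ : StWord n) : ℕ :=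
  ((Finset.Icc 1 (2 * n - 1)).filter
    (fun i => qval n σ (i - 1) < qval n σ i ∧ qval n σ i = qval n σ (i + 1))).card

/-- `L_n^E(x) = Σ_{σ ∈ Q_n, σ_1 < σ_2} x^{ap(σ)}`. -/
noncomputable def LEpoly (n : ℕ) : Polynomial ℝ :=
  ∑ σ ∈ Finset.univ.filter
      (fun σ : StWord n => IsStirling n σ ∧ qval n σ 1 < qval n σ 2),
    X ^ ap n σ

/-- `L_n^O(x) = Σ_{σ ∈ Q_n, σ_1 = σ_2} x^{ap(σ)}`. -/
noncomputable def LOpoly (n : ℕ) : Polynomial ℝ :=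
  ∑ σ ∈ Finset.univ.filter
      (fun σ : StWord n => IsStirling n σ ∧ qval n σ 1 = qval n σ 2),
    X ^ ap n σ

/-- The numbers `L_{n,k}` defined by
`L_{n+1,k} = k·L_{n,k} + L_{n,k-1} + 4(n-k+2)·L_{n,k-2}` with `L_{0,0} = 1`
(and `L_{0,k} = 0` for `k ≠ 0`); one checks that `L_{n,0} = 0` for `n ≥ 1` and
`L_{n,k} = 0` for `k < 0` or `k > n`. -/
def Lnum : ℕ → ℤ → ℝ
  | 0, k => if k = 0 then 1 else 0
  | n + 1, k =>
      (k : ℝ) * Lnum n k + Lnum n (k - 1) +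
        4 * ((n : ℝ) - (k : ℝ) + 2) * Lnum n (k - 2)

/-- The word of order `n + 1` obtained from `σ` by inserting two adjacent copies of the new
largest letter after the first `p` letters. -/
def insertMax (n p : ℕ) (σ : StWord n) : StWord (n + 1) := fun j =>
  if h : j.val < p ∧ j.val < 2 * n then (σ ⟨j.val, h.2⟩).castSucc
  else if h : p + 2 ≤ j.val then (σ ⟨j.val - 2, by omega⟩).castSucc
  else Fin.last n

/-- The position in `insertMax n p σ` of the letter at position `i` of `σ`. -/
def shiftPos (n p : ℕ) (i : Fin (2 * n)) : Fin (2 * (n + 1)) :=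
  if i.val < p then ⟨i.val, by omega⟩ else ⟨i.val + 2, by omega⟩

lemma shiftPos_strictMono (n p : ℕ) : StrictMono (shiftPos n p) := by
  intro i j h
  simp only [shiftPos, Fin.lt_def] at *
  split_ifs <;> simp <;> omega

lemma insertMax_shiftPos (n p : ℕ) (σ : StWord n) (i : Fin (2 * n)) :
    insertMax n p σ (shiftPos n p i) = (σ i).castSucc := by
  unfold insertMax shiftPos
  by_cases h : i.val < p
  · simp [h]
  · have h' : ¬ (i.val + 2 < p) := by omega
    have h'' : p ≤ i.val := by omega
    simp [h, h', h'']

lemma insertMax_eq_last_iff {n p : ℕ} (hp : p ≤ 2 * n) (σ : StWord n)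
    (j : Fin (2 * (n + 1))) :
    insertMax n p σ j = Fin.last n ↔ j.val = p ∨ j.val = p + 1 := by
  unfold insertMax
  have := j.isLt
  split_ifs <;> simp [(Fin.castSucc_lt_last _).ne] <;> omega

lemma exists_shiftPos {n p : ℕ} (hp : p ≤ 2 * n) (j : Fin (2 * (n + 1)))
    (h₁ : j.val ≠ p) (h₂ : j.val ≠ p + 1) : ∃ i, shiftPos n p i = j := by
  have := j.isLt
  rcases lt_or_ge j.val p with h | h
  · exact ⟨⟨j.val, by omega⟩, by simp [shiftPos, h]⟩
  · refine ⟨⟨j.val - 2, by omega⟩, ?_⟩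
    have h' : ¬ (j.val - 2 < p) := by omega
    ext
    simp only [shiftPos, h', if_false]
    omega

lemma isStirling_insertMax_iff {n p : ℕ} (hp : p ≤ 2 * n) (σ : StWord n) :
    IsStirling (n + 1) (insertMax n p σ) ↔ IsStirling n σ := by
  have hcount : ∀ k : Fin n,
      (univ.filter fun j => insertMax n p σ j = k.castSucc).card =
        (univ.filter fun i => σ i = k).card := by
    intro k
    rw [← card_image_of_injective _ (shiftPos_strictMono n p).injective]
    congr 1
    ext j
    simp only [mem_filter, mem_univ, true_and, mem_image]
    constructor
    · intro hj
      have hne : ¬ (insertMax n p σ j = Fin.last n) := by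
        rw [hj]; exact (Fin.castSucc_lt_last _).ne
      rw [insertMax_eq_last_iff hp] at hne
      obtain ⟨i, rfl⟩ := exists_shiftPos hp j (by tauto) (by tauto)
      rw [insertMax_shiftPos] at hj
      exact ⟨i, Fin.castSucc_injective _ hj, rfl⟩
    · rintro ⟨i, hi, rfl⟩
      rw [insertMax_shiftPos, hi]
  constructor
  · rintro ⟨h₁, h₂⟩
    refine ⟨fun k => by rw [← hcount, h₁], fun a b c hab hbc hac => ?_⟩
    have := h₂ _ _ _ (shiftPos_strictMono n p hab) (shiftPos_strictMono n p hbc)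
      (by rw [insertMax_shiftPos, insertMax_shiftPos, hac])
    simpa only [insertMax_shiftPos, Fin.castSucc_lt_castSucc_iff] using this
  · rintro ⟨h₁, h₂⟩
    constructor
    · intro k
      induction k using Fin.lastCases with
      | last =>
        have : (univ.filter fun j => insertMax n p σ j = Fin.last n) =
            {⟨p, by omega⟩, ⟨p + 1, by omega⟩} := by
          ext j
          simp [insertMax_eq_last_iff hp, Fin.ext_iff]
        rw [this, card_pair (by simp)]
      | cast k => rw [hcount, h₁]
    · intro a b c hab hbc hac
      have hlast := insertMax_eq_last_iff hp σ
      by_cases ha : insertMax n p σ a = Fin.last n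
      · have hc := hac ▸ ha
        rw [hlast] at ha hc
        simp only [Fin.lt_def] at hab hbc
        omega
      · have hc := hac ▸ ha
        by_cases hb : insertMax n p σ b = Fin.last n
        · rw [hb]; exact Fin.lt_last_iff_ne_last.2 ha
        · rw [hlast] at ha hb hc
          obtain ⟨a, rfl⟩ := exists_shiftPos hp a (by tauto) (by tauto)
          obtain ⟨b, rfl⟩ := exists_shiftPos hp b (by tauto) (by tauto)
          obtain ⟨c, rfl⟩ := exists_shiftPos hp c (by tauto) (by tauto)
          rw [(shiftPos_strictMono n p).lt_iff_lt] at hab hbc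
          simp only [insertMax_shiftPos, Fin.castSucc_inj, Fin.castSucc_lt_castSucc_iff] at *
          exact h₂ a b c hab hbc hac

lemma exists_insertMax_eq {n : ℕ} {τ : StWord (n + 1)} (hτ : IsStirling (n + 1) τ) :
    ∃ p ≤ 2 * n, ∃ σ : StWord n, insertMax n p σ = τ := by
  obtain ⟨x, y, hxy, hset⟩ := card_eq_two.1 (hτ.1 (Fin.last n))
  wlog hlt : x < y generalizing x y
  · exact this y x hxy.symm (by rw [hset, pair_comm]) (lt_of_le_of_ne (not_lt.1 hlt) hxy.symm)
  have hmem : ∀ j, τ j = Fin.last n ↔ j = x ∨ j = y := fun j => by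
    simpa using Finset.ext_iff.1 hset j
  have hx := (hmem x).2 (Or.inl rfl)
  have hy := (hmem y).2 (Or.inr rfl)
  have hadj : y.val = x.val + 1 := by
    by_contra hne
    have hlt' : x.val < y.val := hlt
    have hb := hτ.2 x ⟨x.val + 1, by omega⟩ y (by simp [Fin.lt_def])
      (by simp only [Fin.lt_def]; omega) (hx.trans hy.symm)
    rw [hx] at hb
    exact absurd hb (not_lt.2 (Fin.le_last _))
  have hp : x.val ≤ 2 * n := by omega
  have hne : ∀ i, τ (shiftPos n x.val i) ≠ Fin.last n := by
    intro i h
    rw [hmem] at h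
    simp only [shiftPos, Fin.ext_iff] at h
    split_ifs at h <;> simp at h <;> omega
  refine ⟨x.val, hp, fun i => (τ (shiftPos n x.val i)).castPred (hne i), ?_⟩
  ext1 j
  by_cases hj : τ j = Fin.last n
  · rw [hj, insertMax_eq_last_iff hp]
    rw [hmem, Fin.ext_iff, Fin.ext_iff] at hj
    omega
  · rw [hmem, Fin.ext_iff, Fin.ext_iff] at hj
    obtain ⟨i, rfl⟩ := exists_shiftPos hp j (by omega) (by omega)
    rw [insertMax_shiftPos, Fin.castSucc_castPred]

lemma insertMax_inj {n p q : ℕ} (hp : p ≤ 2 * n) (hq : q ≤ 2 * n) {σ ρ : StWord n}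
    (h : insertMax n p σ = insertMax n q ρ) : p = q ∧ σ = ρ := by
  have hmem : ∀ j : Fin (2 * (n + 1)),
      (j.val = p ∨ j.val = p + 1) ↔ (j.val = q ∨ j.val = q + 1) := fun j => by
    rw [← insertMax_eq_last_iff hp σ, h, insertMax_eq_last_iff hq]
  have hpq : p = q := by
    have h₁ := (hmem ⟨p, by omega⟩).1 (Or.inl rfl)
    have h₂ := (hmem ⟨q, by omega⟩).2 (Or.inl rfl)
    simp only at h₁ h₂
    omega
  subst hpq
  refine ⟨rfl, funext fun i => Fin.castSucc_injective _ ?_⟩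
  rw [← insertMax_shiftPos n p σ, h, insertMax_shiftPos]

lemma sum_isStirling_succ {M : Type*} [AddCommMonoid M] (n : ℕ) (F : StWord (n + 1) → M) :
    ∑ τ ∈ univ.filter (IsStirling (n + 1)), F τ =
      ∑ σ ∈ univ.filter (IsStirling n), ∑ p ∈ range (2 * n + 1), F (insertMax n p σ) := by
  rw [← sum_product' _ _ fun σ p => F (insertMax n p σ)]
  symm
  refine sum_bij (fun x _ => insertMax n x.2 x.1) ?_ ?_ ?_ fun _ _ => rfl
  · rintro ⟨σ, p⟩ h
    simp only [mem_product, mem_filter, mem_univ, true_and, mem_range] at h ⊢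
    exact (isStirling_insertMax_iff (by omega) σ).2 h.1
  · rintro ⟨σ, p⟩ h ⟨ρ, q⟩ h' heq
    simp only [mem_product, mem_filter, mem_univ, true_and, mem_range] at h h'
    obtain ⟨h₁, h₂⟩ := insertMax_inj (by omega) (by omega) heq
    exact Prod.ext h₂ h₁
  · intro τ hτ
    simp only [mem_filter, mem_univ, true_and] at hτ
    obtain ⟨p, hp, σ, rfl⟩ := exists_insertMax_eq hτ
    refine ⟨(σ, p), ?_, rfl⟩
    simp only [mem_product, mem_filter, mem_univ, true_and, mem_range]
    exact ⟨(isStirling_insertMax_iff hp σ).1 hτ, by omega⟩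

lemma qval_le (n : ℕ) (σ : StWord n) (i : ℕ) : qval n σ i ≤ n := by
  unfold qval
  split_ifs <;> omega

lemma qval_pos_iff (n : ℕ) (σ : StWord n) (i : ℕ) :
    0 < qval n σ i ↔ 1 ≤ i ∧ i ≤ 2 * n := by
  unfold qval
  split_ifs with h <;> simp [h]

lemma qval_insertMax {n p : ℕ} (hp : p ≤ 2 * n) (σ : StWord n) (j : ℕ) :
    qval (n + 1) (insertMax n p σ) j =
      if j ≤ p then qval n σ j else if j ≤ p + 2 then n + 1 else qval n σ (j - 2) := by
  unfold qval insertMax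
  by_cases h₁ : j ≤ p
  · rw [if_pos h₁]
    by_cases h : 1 ≤ j
    · rw [dif_pos (show 1 ≤ j ∧ j ≤ 2 * (n + 1) by omega),
        dif_pos (show j - 1 < p ∧ j - 1 < 2 * n by omega),
        dif_pos (show 1 ≤ j ∧ j ≤ 2 * n by omega), Fin.val_castSucc]
    · rw [dif_neg (by omega), dif_neg (by omega)]
  rw [if_neg h₁]
  by_cases h₂ : j ≤ p + 2
  · rw [if_pos h₂, dif_pos ⟨by omega, by omega⟩, dif_neg (by dsimp only; omega),
      dif_neg (by dsimp only; omega), Fin.val_last]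
  rw [if_neg h₂]
  by_cases h : j ≤ 2 * (n + 1)
  · rw [dif_pos (show 1 ≤ j ∧ j ≤ 2 * (n + 1) by omega),
      dif_neg (show ¬ (j - 1 < p ∧ j - 1 < 2 * n) by omega),
      dif_pos (show p + 2 ≤ j - 1 by omega),
      dif_pos (show 1 ≤ j - 2 ∧ j - 2 ≤ 2 * n by omega), Fin.val_castSucc]
    simp only [Nat.sub_right_comm]
  · rw [dif_neg (by omega), dif_neg (by omega)]

/-- The set of ascent-plateaus of a word. -/
def apSet (n : ℕ) (σ : StWord n) : Finset ℕ :=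
  (Icc 2 (2 * n - 1)).filter
    (fun i => qval n σ (i - 1) < qval n σ i ∧ qval n σ i = qval n σ (i + 1))

lemma card_apSet (n : ℕ) (σ : StWord n) : (apSet n σ).card = ap n σ := rfl

lemma mem_apSet {n : ℕ} {σ : StWord n} {i : ℕ} :
    i ∈ apSet n σ ↔
      2 ≤ i ∧ qval n σ (i - 1) < qval n σ i ∧ qval n σ i = qval n σ (i + 1) := by
  simp only [apSet, mem_filter, mem_Icc]
  have h₁ := qval_pos_iff n σ i
  have h₂ := qval_pos_iff n σ (i + 1)
  constructor
  · rintro ⟨⟨h, -⟩, h'⟩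
    exact ⟨h, h'⟩
  · rintro ⟨h, h', h''⟩
    omega

lemma mem_apSet_insertMax {n p : ℕ} (hp : p ≤ 2 * n) (σ : StWord n) (j : ℕ) :
    j ∈ apSet (n + 1) (insertMax n p σ) ↔
      (j < p ∧ j ∈ apSet n σ) ∨ (1 ≤ p ∧ j = p + 1) ∨ (p + 4 ≤ j ∧ j - 2 ∈ apSet n σ) := by
  have hle := qval_le n σ
  simp only [mem_apSet, qval_insertMax hp]
  have e₁ : j - 2 - 1 = j - 1 - 2 := by omega
  have := hle j
  have := hle (j - 1)
  have := hle (j + 1)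
  have := hle (j - 2)
  have := hle (j - 1 - 2)
  have := hle (j + 1 - 2)
  rcases lt_or_ge j 2 with h | h
  · omega
  have e₂ : j - 2 + 1 = j + 1 - 2 := by omega
  rw [e₁, e₂]
  split_ifs <;> omega

lemma card_eq_add_ite_mem (A : Finset ℕ) (p : ℕ) :
    A.card = (A.filter (· < p)).card + (A.filter (p + 1 < ·)).card +
      (if p ∈ A then 1 else 0) + (if p + 1 ∈ A then 1 else 0) := by
  rw [card_filter, card_filter, ← sum_ite_eq' A p fun _ => 1, ← sum_ite_eq' A (p + 1) fun _ => 1,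
    ← sum_add_distrib, ← sum_add_distrib, ← sum_add_distrib, card_eq_sum_ones]
  refine sum_congr rfl fun i _ => ?_
  split_ifs <;> omega

lemma card_union_shift_union (A : Finset ℕ) (p : ℕ) :
    ((A.filter (· < p) ∪ (A.filter (p + 1 < ·)).image (· + 2)) ∪
      (if 1 ≤ p then {p + 1} else ∅)).card =
      (A.filter (· < p)).card + (A.filter (p + 1 < ·)).card + if 1 ≤ p then 1 else 0 := by
  rw [card_union_of_disjoint, card_union_of_disjoint,
    card_image_of_injective _ (add_left_injective 2), apply_ite card, card_singleton, card_empty]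
  · rw [disjoint_left]
    intro j
    simp only [mem_filter, mem_image]
    rintro ⟨-, h⟩ ⟨a, ⟨-, h'⟩, rfl⟩
    omega
  · split_ifs
    · rw [disjoint_singleton_right]
      simp only [mem_union, mem_filter, mem_image]
      rintro (⟨-, h⟩ | ⟨a, ⟨-, h⟩, h'⟩) <;> omega
    · exact disjoint_empty_right _

lemma ap_insertMax_add {n p : ℕ} (hp : p ≤ 2 * n) (σ : StWord n) :
    ap (n + 1) (insertMax n p σ) + (if p ∈ apSet n σ then 1 else 0) +
      (if p + 1 ∈ apSet n σ then 1 else 0) = ap n σ + if 1 ≤ p then 1 else 0 := by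
  have h₁ : apSet (n + 1) (insertMax n p σ) =
      ((apSet n σ).filter (· < p) ∪ ((apSet n σ).filter (p + 1 < ·)).image (· + 2)) ∪
        (if 1 ≤ p then {p + 1} else ∅) := by
    ext j
    rw [mem_apSet_insertMax hp]
    simp only [mem_union, mem_filter, mem_image]
    have : (∃ a, (a ∈ apSet n σ ∧ p + 1 < a) ∧ a + 2 = j) ↔
        (p + 4 ≤ j ∧ j - 2 ∈ apSet n σ) := by
      constructor
      · rintro ⟨a, ⟨h, h'⟩, rfl⟩
        exact ⟨by omega, h⟩
      · rintro ⟨h, h'⟩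
        exact ⟨j - 2, ⟨h', by omega⟩, by omega⟩
    rw [this]
    split_ifs with h <;> simp [h] <;> tauto
  have c₁ := congrArg card h₁
  rw [card_union_shift_union] at c₁
  have c₂ := card_eq_add_ite_mem (apSet n σ) p
  rw [card_apSet] at c₁ c₂
  omega

lemma notMem_apSet_of_mem {n : ℕ} {σ : StWord n} {p : ℕ} (h : p ∈ apSet n σ) :
    p + 1 ∉ apSet n σ := by
  rw [mem_apSet] at *
  simp only [add_tsub_cancel_right]
  omega

lemma X_pow_ap_insertMax {n p : ℕ} (hp : p < 2 * n) (σ : StWord n) :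
    (X : ℝ[X]) ^ ap (n + 1) (insertMax n (p + 1) σ) = X ^ (ap n σ + 1) +
      ((if p + 1 ∈ apSet n σ then 1 else 0) + (if p + 2 ∈ apSet n σ then 1 else 0)) *
        (X ^ ap n σ - X ^ (ap n σ + 1)) := by
  have h := ap_insertMax_add (p := p + 1) (by omega) σ
  by_cases h₁ : p + 1 ∈ apSet n σ
  · have h₂ : p + 2 ∉ apSet n σ := notMem_apSet_of_mem h₁
    simp [h₁, h₂] at h ⊢
    rw [h]
  · by_cases h₂ : p + 2 ∈ apSet n σ
    · simp [h₁, h₂] at h ⊢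
      rw [h]
    · simp [h₁, h₂] at h ⊢
      rw [h]

lemma sum_ite_mem_apSet (n : ℕ) (σ : StWord n) {r : ℕ} (hr : r = 1 ∨ r = 2) :
    ∑ p ∈ range (2 * n), (if p + r ∈ apSet n σ then 1 else 0 : ℝ[X]) = ap n σ := by
  rw [sum_boole, ← card_apSet]
  congr 1
  rw [← card_image_of_injective _ (add_left_injective r)]
  congr 1
  ext j
  simp only [mem_image, mem_filter, mem_range]
  constructor
  · rintro ⟨a, ⟨-, h⟩, rfl⟩
    exact h
  · intro h
    have h' := h
    simp only [apSet, mem_filter, mem_Icc] at h'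
    refine ⟨j - r, ⟨by omega, ?_⟩, by omega⟩
    rwa [show j - r + r = j by omega]

/-- The differential operator describing the insertion of a new largest letter. -/
noncomputable def insertOp (d : ℕ) (f : ℝ[X]) : ℝ[X] :=
  2 * (d : ℝ[X]) * X * f + 2 * X * (1 - X) * derivative f

lemma insertOp_sum {ι : Type*} (d : ℕ) (s : Finset ι) (f : ι → ℝ[X]) :
    insertOp d (∑ i ∈ s, f i) = ∑ i ∈ s, insertOp d (f i) := by
  simp only [insertOp, derivative_sum, mul_sum, sum_add_distrib]

lemma sum_X_pow_ap_insertMax (n : ℕ) (σ : StWord n) :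
    ∑ p ∈ range (2 * n), (X : ℝ[X]) ^ ap (n + 1) (insertMax n (p + 1) σ) =
      insertOp n (X ^ ap n σ) := by
  rw [sum_congr rfl fun p hp => X_pow_ap_insertMax (mem_range.1 hp) σ, sum_add_distrib,
    ← sum_mul, sum_add_distrib, sum_ite_mem_apSet n σ (Or.inl rfl),
    sum_ite_mem_apSet n σ (Or.inr rfl)]
  simp only [sum_const, card_range, nsmul_eq_mul, insertOp]
  rcases Nat.eq_zero_or_pos (ap n σ) with h | h
  · simp [h]
  · obtain ⟨a, ha⟩ := Nat.exists_eq_succ_of_ne_zero h.ne'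
    rw [ha]
    simp only [derivative_X_pow, Nat.succ_eq_add_one, Nat.add_sub_cancel]
    push_cast
    simp only [map_add, map_natCast, map_one]
    ring

lemma qval_one_le_two {n : ℕ} {σ : StWord n} (hσ : IsStirling n σ) :
    qval n σ 1 ≤ qval n σ 2 := by
  rcases Nat.eq_zero_or_pos n with rfl | hn
  · simp [qval]
  by_contra! hlt
  have h₁ : σ ⟨1, by omega⟩ < σ ⟨0, by omega⟩ := by
    simpa [qval, show 1 ≤ 2 * n by omega, show 1 ≤ n by omega] using hlt
  obtain ⟨x, hx, hne⟩ := exists_mem_ne (by rw [hσ.1 (σ ⟨0, by omega⟩)]; norm_num)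
    (⟨0, by omega⟩ : Fin (2 * n))
  simp only [mem_filter, mem_univ, true_and] at hx
  have hx0 : x.val ≠ 0 := fun h => hne (Fin.ext h)
  have hx1 : x.val ≠ 1 := fun h => by
    rw [show x = ⟨1, by omega⟩ from Fin.ext h] at hx
    exact h₁.ne hx
  have := hσ.2 ⟨0, by omega⟩ ⟨1, by omega⟩ x (by simp [Fin.lt_def])
    (by simp only [Fin.lt_def]; omega) hx.symm
  exact absurd this (not_lt.2 h₁.le)

lemma LEpoly_eq_sum_ite (n : ℕ) : LEpoly n =
    ∑ σ ∈ univ.filter (IsStirling n), if qval n σ 1 < qval n σ 2 then X ^ ap n σ else 0 := by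
  rw [LEpoly, ← sum_filter, filter_filter]

lemma LOpoly_eq_sum_ite (n : ℕ) : LOpoly n =
    ∑ σ ∈ univ.filter (IsStirling n), if qval n σ 1 = qval n σ 2 then X ^ ap n σ else 0 := by
  rw [LOpoly, ← sum_filter, filter_filter]

lemma ap_insertMax_zero (n : ℕ) (σ : StWord n) : ap (n + 1) (insertMax n 0 σ) = ap n σ := by
  simpa [mem_apSet] using ap_insertMax_add (p := 0) (by omega) σ

lemma qval_insertMax_zero (n : ℕ) (σ : StWord n) :
    qval (n + 1) (insertMax n 0 σ) 1 = qval (n + 1) (insertMax n 0 σ) 2 := by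
  simp [qval_insertMax]

lemma LEpoly_succ {n : ℕ} (hn : 1 ≤ n) :
    LEpoly (n + 1) = insertOp n (LEpoly n) + X * LOpoly n := by
  rw [LEpoly_eq_sum_ite, sum_isStirling_succ, LEpoly_eq_sum_ite, LOpoly_eq_sum_ite, insertOp_sum,
    mul_sum, ← sum_add_distrib]
  refine sum_congr rfl fun σ hσ => ?_
  simp only [mem_filter, mem_univ, true_and] at hσ
  rw [sum_range_succ', if_neg (qval_insertMax_zero n σ).not_lt, add_zero]
  have hle := qval_le n σ 1
  rcases (qval_one_le_two hσ).lt_or_eq with h | h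
  · rw [if_pos h, if_neg h.ne, mul_zero, add_zero, ← sum_X_pow_ap_insertMax]
    refine sum_congr rfl fun p hp => ?_
    rw [if_pos]
    rw [mem_range] at hp
    rw [qval_insertMax (by omega), qval_insertMax (by omega)]
    split_ifs <;> omega
  · rw [if_neg h.not_lt, if_pos h]
    rw [sum_eq_single_of_mem 0 (by rw [mem_range]; omega), if_pos]
    · rw [X_pow_ap_insertMax (by omega)]
      simp [mem_apSet, h, insertOp]
      ring
    · rw [qval_insertMax (by omega), qval_insertMax (by omega)]
      split_ifs <;> omega
    · intro p hp h0
      rw [mem_range] at hp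
      rw [if_neg]
      rw [qval_insertMax (by omega), qval_insertMax (by omega)]
      split_ifs <;> omega

lemma LOpoly_succ {n : ℕ} (hn : 1 ≤ n) :
    LOpoly (n + 1) = LEpoly n + LOpoly n + insertOp n (LOpoly n) - X * LOpoly n := by
  rw [LOpoly_eq_sum_ite, sum_isStirling_succ, LEpoly_eq_sum_ite, LOpoly_eq_sum_ite, insertOp_sum,
    mul_sum, ← sum_add_distrib, ← sum_add_distrib, ← sum_sub_distrib]
  refine sum_congr rfl fun σ hσ => ?_
  simp only [mem_filter, mem_univ, true_and] at hσ
  rw [sum_range_succ', if_pos (qval_insertMax_zero n σ), ap_insertMax_zero]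
  have hle := qval_le n σ 1
  have hone : qval (n + 1) (insertMax n (0 + 1) σ) 1 ≠ qval (n + 1) (insertMax n (0 + 1) σ) 2 := by
    rw [qval_insertMax (by omega), qval_insertMax (by omega)]
    split_ifs <;> omega
  rcases (qval_one_le_two hσ).lt_or_eq with h | h
  · rw [if_pos h, if_neg h.ne, sum_eq_zero]
    · simp [insertOp]
    · intro p hp
      rw [mem_range] at hp
      rw [if_neg]
      rw [qval_insertMax (by omega), qval_insertMax (by omega)]
      split_ifs <;> omega
  · rw [if_neg h.not_lt, if_pos h, ← sum_X_pow_ap_insertMax]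
    obtain ⟨m, hm⟩ : ∃ m, 2 * n = m + 1 := ⟨2 * n - 1, by omega⟩
    rw [hm, sum_range_succ', sum_range_succ', if_neg hone, X_pow_ap_insertMax (by omega)]
    have hsum : ∀ p ∈ range m, (if qval (n + 1) (insertMax n (p + 1 + 1) σ) 1 =
          qval (n + 1) (insertMax n (p + 1 + 1) σ) 2
        then (X : ℝ[X]) ^ ap (n + 1) (insertMax n (p + 1 + 1) σ) else 0) =
        X ^ ap (n + 1) (insertMax n (p + 1 + 1) σ) := by
      intro p hp
      rw [mem_range] at hp
      rw [if_pos]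
      rw [qval_insertMax (by omega), qval_insertMax (by omega)]
      split_ifs <;> omega
    rw [sum_congr rfl hsum]
    simp [mem_apSet, h]
    ring

lemma filter_isStirling_zero : univ.filter (IsStirling 0) = univ := by
  refine filter_true_of_mem fun σ _ => ⟨fun k => k.elim0, fun a => a.elim0⟩

lemma LEpoly_one : LEpoly 1 = 0 := by
  rw [LEpoly_eq_sum_ite, sum_isStirling_succ]
  refine sum_eq_zero fun σ _ => ?_
  simp [qval_insertMax_zero]

lemma LOpoly_one : LOpoly 1 = 1 := by
  rw [LOpoly_eq_sum_ite, sum_isStirling_succ, filter_isStirling_zero]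
  simp only [mul_zero, zero_add, sum_range_one, qval_insertMax_zero, if_true, ap_insertMax_zero]
  simp [ap]

lemma Lnum_succ (n : ℕ) (k : ℤ) : Lnum (n + 1) k =
    (k : ℝ) * Lnum n k + Lnum n (k - 1) + 4 * ((n : ℝ) - (k : ℝ) + 2) * Lnum n (k - 2) := rfl

lemma Lnum_eq_zero_of_lt {n : ℕ} {k : ℤ} (h : (n : ℤ) < k) : Lnum n k = 0 := by
  induction n generalizing k with
  | zero => simp only [Lnum]; rw [if_neg]; push_cast at h; omega
  | succ n ih =>
    push_cast at h
    rw [Lnum_succ, ih (by omega), ih (by omega)]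
    rcases (show (n : ℤ) + 2 ≤ k by omega).eq_or_lt with rfl | h'
    · push_cast; ring
    · rw [ih (by omega)]; ring

lemma Lnum_eq_zero_of_neg {n : ℕ} {k : ℤ} (h : k < 0) : Lnum n k = 0 := by
  induction n generalizing k with
  | zero => simp only [Lnum]; rw [if_neg]; omega
  | succ n ih => rw [Lnum_succ, ih h, ih (by omega), ih (by omega)]; ring

lemma Lnum_succ_zero (n : ℕ) : Lnum (n + 1) 0 = 0 := by
  rw [Lnum_succ, Lnum_eq_zero_of_neg (k := 0 - 1) (by omega),
    Lnum_eq_zero_of_neg (k := 0 - 2) (by omega)]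
  simp

lemma Lnum_nonneg (n : ℕ) (k : ℤ) : 0 ≤ Lnum n k := by
  induction n generalizing k with
  | zero => simp only [Lnum]; split_ifs <;> norm_num
  | succ n ih =>
    rcases lt_or_ge k 0 with hk | hk
    · rw [Lnum_eq_zero_of_neg hk]
    rcases lt_or_ge ((n + 1 : ℕ) : ℤ) k with hk' | hk'
    · rw [Lnum_eq_zero_of_lt hk']
    rw [Lnum_succ]
    have h₁ : (0 : ℝ) ≤ k := by exact_mod_cast hk
    have h₂ : (k : ℝ) ≤ n + 1 := by exact_mod_cast hk'
    have := mul_nonneg h₁ (ih k)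
    have := mul_nonneg (show (0 : ℝ) ≤ 4 * (n - k + 2) by linarith) (ih (k - 2))
    linarith [ih (k - 1)]

/-- The basis polynomials of the `γ`-expansion in degree `d`. -/
noncomputable def gammaBasis (d k : ℕ) : ℝ[X] := X ^ k * (1 + X) ^ (d - 2 * k)

lemma X_mul_gammaBasis (d k : ℕ) : X * gammaBasis d k = gammaBasis (d + 2) (k + 1) := by
  rw [gammaBasis, gammaBasis, show d + 2 - 2 * (k + 1) = d - 2 * k by omega]
  ring

lemma one_add_X_mul_gammaBasis {d k : ℕ} (h : 2 * k ≤ d) :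
    (1 + X) * gammaBasis d k = gammaBasis (d + 1) k := by
  rw [gammaBasis, gammaBasis, show d + 1 - 2 * k = d - 2 * k + 1 by omega]
  ring

lemma insertOp_gammaBasis {d k : ℕ} (h : 2 * k ≤ d) :
    insertOp d (gammaBasis d k) = 2 * (k : ℝ[X]) * gammaBasis (d + 1) k +
      4 * ((d : ℝ[X]) - 2 * k) * gammaBasis (d + 1) (k + 1) := by
  obtain ⟨m, rfl⟩ := Nat.exists_eq_add_of_le h
  simp only [gammaBasis, insertOp, derivative_mul, derivative_pow,
    derivative_add, derivative_one, derivative_X, map_natCast, zero_add, mul_one]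
  rw [show 2 * k + m - 2 * k = m by omega, show 2 * k + m + 1 - 2 * k = m + 1 by omega,
    show 2 * k + m + 1 - 2 * (k + 1) = m - 1 by omega]
  rcases k with _ | k <;> rcases m with _ | m <;> simp <;> ring

lemma insertOp_C_mul (d : ℕ) (c : ℝ) (f : ℝ[X]) :
    insertOp d (C c * f) = C c * insertOp d f := by
  simp only [insertOp, derivative_C_mul]
  ring

/-- Shifting the index in a sum whose boundary coefficients vanish. -/
lemma sum_C_mul_shift (c : ℤ → ℝ) (b : ℕ → ℝ[X]) (N : ℕ) (h₀ : c (-1) = 0)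
    (h₁ : c N = 0) :
    ∑ k ∈ range (N + 1), C (c k) * b (k + 1) = ∑ k ∈ range (N + 1), C (c (k - 1)) * b k := by
  rw [sum_range_succ, sum_range_succ', h₁]
  simp [h₀]

lemma gammaBasis_expansion (m N : ℕ) (hN : m + 1 ≤ N) :
    LEpoly (m + 1) = ∑ k ∈ range N, C (Lnum (m + 1) (2 * (k : ℤ))) * gammaBasis (m + 1) k ∧
    LOpoly (m + 1) = ∑ k ∈ range N, C (Lnum (m + 1) (2 * (k : ℤ) + 1)) * gammaBasis m k := by
  induction m generalizing N with
  | zero =>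
    obtain ⟨N, rfl⟩ := Nat.exists_eq_add_of_le' hN
    rw [zero_add, LEpoly_one, LOpoly_one]
    constructor
    · refine (sum_eq_zero fun k _ => ?_).symm
      rcases k with _ | k
      · rw [Nat.cast_zero, mul_zero, Lnum_succ_zero]; simp
      · rw [Lnum_eq_zero_of_lt (by push_cast; omega)]; simp
    · rw [sum_range_succ', sum_eq_zero fun k _ => ?_]
      · simp [Lnum, gammaBasis]
      · rw [Lnum_eq_zero_of_lt (by push_cast; omega)]; simp
  | succ m ih =>
    obtain ⟨hE, hO⟩ := ih N (by omega)
    obtain ⟨N, rfl⟩ := Nat.exists_eq_add_of_le' (show 1 ≤ N by omega)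
    have opE : insertOp (m + 1) (LEpoly (m + 1)) = ∑ k ∈ range (N + 1),
        (C (2 * (k : ℝ) * Lnum (m + 1) (2 * (k : ℤ))) * gammaBasis (m + 2) k +
          C (4 * ((m : ℝ) + 1 - 2 * k) * Lnum (m + 1) (2 * (k : ℤ))) *
            gammaBasis (m + 2) (k + 1)) := by
      rw [hE, insertOp_sum]
      refine sum_congr rfl fun k _ => ?_
      rw [insertOp_C_mul]
      rcases le_or_gt (2 * k) (m + 1) with h | h
      · rw [insertOp_gammaBasis h]
        simp only [map_mul, map_sub, map_add, map_natCast, map_one, map_ofNat]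
        push_cast
        ring
      · rw [Lnum_eq_zero_of_lt (by push_cast; omega)]; simp
    have opO : (1 + X) * LOpoly (m + 1) + insertOp m (LOpoly (m + 1)) = ∑ k ∈ range (N + 1),
        (C ((2 * (k : ℝ) + 1) * Lnum (m + 1) (2 * (k : ℤ) + 1)) * gammaBasis (m + 1) k +
          C (4 * ((m : ℝ) - 2 * k) * Lnum (m + 1) (2 * (k : ℤ) + 1)) *
            gammaBasis (m + 1) (k + 1)) := by
      rw [hO, insertOp_sum, mul_sum, ← sum_add_distrib]
      refine sum_congr rfl fun k _ => ?_
      rw [insertOp_C_mul]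
      rcases le_or_gt (2 * k) m with h | h
      · rw [insertOp_gammaBasis h, mul_left_comm, one_add_X_mul_gammaBasis h]
        simp only [map_mul, map_sub, map_add, map_natCast, map_one, map_ofNat]
        ring
      · rw [Lnum_eq_zero_of_lt (by push_cast; omega)]; simp
    have hXO : X * LOpoly (m + 1) = ∑ k ∈ range (N + 1),
        C (Lnum (m + 1) (2 * (k : ℤ) + 1)) * gammaBasis (m + 2) (k + 1) := by
      rw [hO, mul_sum]
      exact sum_congr rfl fun k _ => by rw [mul_left_comm, X_mul_gammaBasis]
    constructor
    · have hs := sum_C_mul_shift (fun k => 4 * ((m : ℝ) + 1 - 2 * k) * Lnum (m + 1) (2 * k) +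
        Lnum (m + 1) (2 * k + 1)) (gammaBasis (m + 2)) N
        (by simp [Lnum_eq_zero_of_neg])
        (by
          rw [Lnum_eq_zero_of_lt (by push_cast; omega), Lnum_eq_zero_of_lt (by push_cast; omega)]
          ring)
      rw [LEpoly_succ (by omega), opE, hXO, ← sum_add_distrib]
      trans ∑ k ∈ range (N + 1), C (2 * (k : ℝ) * Lnum (m + 1) (2 * (k : ℤ))) *
          gammaBasis (m + 2) k + ∑ k ∈ range (N + 1),
        C (4 * ((m : ℝ) + 1 - 2 * k) * Lnum (m + 1) (2 * k) + Lnum (m + 1) (2 * (k : ℤ) + 1)) *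
          gammaBasis (m + 2) (k + 1)
      · rw [← sum_add_distrib]
        refine sum_congr rfl fun k _ => ?_
        rw [C_add]; ring
      · simp only [Int.cast_natCast] at hs
        rw [hs, ← sum_add_distrib]
        refine sum_congr rfl fun k _ => ?_
        rw [← add_mul, ← C_add, Lnum_succ (m + 1)]
        congr 2
        rw [show 2 * ((k : ℤ) - 1) = 2 * k - 2 by ring,
          show 2 * (k : ℤ) - 2 + 1 = 2 * k - 1 by ring]
        push_cast
        ring
    · have hs := sum_C_mul_shift (fun k => 4 * ((m : ℝ) - 2 * k) * Lnum (m + 1) (2 * k + 1))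
        (gammaBasis (m + 1)) N
        (by simp [Lnum_eq_zero_of_neg])
        (by
          rw [Lnum_eq_zero_of_lt (by push_cast; omega)]
          ring)
      have hop : insertOp (m + 1) (LOpoly (m + 1)) =
          insertOp m (LOpoly (m + 1)) + 2 * X * LOpoly (m + 1) := by
        simp only [insertOp]; push_cast; ring
      have hrec : LOpoly (m + 1 + 1) = LEpoly (m + 1) +
          ((1 + X) * LOpoly (m + 1) + insertOp m (LOpoly (m + 1))) := by
        rw [LOpoly_succ (by omega), hop]; ring
      simp only [Int.cast_natCast] at hs
      rw [hrec, opO, hE, sum_add_distrib, hs, ← sum_add_distrib, ← sum_add_distrib]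
      refine sum_congr rfl fun k _ => ?_
      rw [← add_mul, ← C_add, ← add_mul, ← C_add, Lnum_succ (m + 1)]
      congr 2
      rw [show 2 * ((k : ℤ) - 1) + 1 = 2 * k + 1 - 2 by ring,
        show 2 * (k : ℤ) + 1 - 1 = 2 * k by ring]
      push_cast
      ring

/-- For every `n ≥ 1`, the numbers `L_{n,k}` are nonnegative and
`L_n^E(x) = Σ_{k=1}^{⌊n/2⌋} L_{n,2k} x^k (1+x)^{n-2k}`,
`L_n^O(x) = Σ_{k=0}^{⌊(n-1)/2⌋} L_{n,2k+1} x^k (1+x)^{n-1-2k}`;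
in particular both `L_n^E` and `L_n^O` are γ-positive. -/
theorem LE_LO_gamma_positive (n : ℕ) (hn : 1 ≤ n) :
    (∀ k : ℤ, 0 ≤ Lnum n k) ∧
    LEpoly n =
      ∑ k ∈ Finset.Icc 1 (n / 2),
        Polynomial.C (Lnum n (2 * (k : ℤ))) * X ^ k * (1 + X) ^ (n - 2 * k) ∧
    LOpoly n =
      ∑ k ∈ Finset.range ((n - 1) / 2 + 1),
        Polynomial.C (Lnum n (2 * (k : ℤ) + 1)) * X ^ k *
          (1 + X) ^ (n - 1 - 2 * k) := by
  obtain ⟨m, rfl⟩ := Nat.exists_eq_add_of_le' hn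
  obtain ⟨hE, hO⟩ := gammaBasis_expansion m (m + 1) le_rfl
  refine ⟨Lnum_nonneg _, ?_, ?_⟩
  · rw [hE]
    symm
    simp only [mul_assoc]
    refine sum_subset (fun k hk => ?_) fun k _ hk => ?_
    · simp only [mem_Icc, mem_range] at hk ⊢
      omega
    · rcases k with _ | k
      · rw [Nat.cast_zero, mul_zero, Lnum_succ_zero]; simp
      · rw [mem_Icc] at hk
        rw [Lnum_eq_zero_of_lt (by push_cast; omega)]; simp
  · rw [hO]
    symm
    simp only [mul_assoc, Nat.add_sub_cancel]
    refine sum_subset (fun k hk => ?_) fun k _ hk => ?_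
    · simp only [mem_range] at hk ⊢
      omega
    · rw [mem_range] at hk
      rw [Lnum_eq_zero_of_lt (by push_cast; omega)]; simp
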